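/- arXiv:2305.06864 — 6 statements merged into one kernel-verified Lean document; each statement's English description precedes it below -/
import Mathlib

section
/- Let α ≥ 1 and β ≥ 0 be natural numbers and let G be a finite simple graph that is (α,β)-compact. Then every connected component H of G is (α,β)-compact, and dist_H(z,z') ≤ α(2β+1) − 1 for all vertices z, z' of H; in particular the diameter of H is at most α(2β+1) − 1. -/
/-- A graph `G` is `(α, β)`-compact if its vertex set can be covered by at most `α`
balls of radius `β` (centered at vertices of `G`); the empty graph is compact by
convention (take the empty set of centers). -/
def IsCompactGraph {V : Type*} (G : SimpleGraph V) (α β : ℕ) : Prop :=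
  ∃ Z : Finset V, Z.card ≤ α ∧ ∀ v : V, ∃ z ∈ Z, G.edist z v ≤ (β : ℕ∞)

lemma edist_bound_aux {V : Type*} (G : SimpleGraph V) (α β : ℕ)
    (h : IsCompactGraph G α β) (x y : V) (hr : G.Reachable x y) :
    G.edist x y ≤ ((α * (2 * β + 1) - 1 : ℕ) : ℕ∞) := by
  classical
  obtain ⟨Z, hZ, hc⟩ := h
  choose c hcZ hcd using hc
  obtain ⟨p, hp⟩ := hr.exists_walk_length_eq_edist
  set n := p.length with hn
  have key : ∀ i j : ℕ, i ≤ j → j ≤ n → c (p.getVert i) = c (p.getVert j) → j ≤ i + 2 * β := by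
    intro i j hij hj he
    have h1 : G.edist x (p.getVert i) ≤ (i : ℕ∞) := by
      refine (SimpleGraph.Walk.edist_le (p.take i)).trans ?_
      have : (p.take i).length ≤ i := by simp
      exact_mod_cast this
    have h2 : G.edist (p.getVert j) y ≤ ((n - j : ℕ) : ℕ∞) := by
      refine (SimpleGraph.Walk.edist_le (p.drop j)).trans ?_
      have : (p.drop j).length ≤ n - j := by simp [hn]
      exact_mod_cast this
    have h3 : G.edist (p.getVert i) (p.getVert j) ≤ ((β + β : ℕ) : ℕ∞) := by
      refine (SimpleGraph.edist_triangle (v := c (p.getVert i))).trans ?_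
      push_cast
      refine add_le_add ?_ ?_
      · rw [SimpleGraph.edist_comm]; exact hcd _
      · rw [he]; exact hcd _
    have h4 : (n : ℕ∞) ≤ ((i + ((β + β) + (n - j)) : ℕ) : ℕ∞) := by
      rw [hp]
      refine (SimpleGraph.edist_triangle (v := p.getVert i)).trans ?_
      rw [Nat.cast_add]
      refine add_le_add h1 ((SimpleGraph.edist_triangle (v := p.getVert j)).trans ?_)
      rw [Nat.cast_add]
      exact add_le_add h3 h2
    have h5 : n ≤ i + ((β + β) + (n - j)) := by exact_mod_cast h4
    omega
  have hcard : (Finset.range (n + 1)).card ≤ (2 * β + 1) * Z.card := by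
    refine Finset.card_le_mul_card_image_of_maps_to (f := fun i => c (p.getVert i))
      (fun i _ => hcZ _) _ ?_
    intro z _
    set S := (Finset.range (n + 1)).filter (fun i => c (p.getVert i) = z) with hS
    by_cases hne : S.Nonempty
    · have hm := S.min'_mem hne
      have hsub : S ⊆ Finset.Icc (S.min' hne) (S.min' hne + 2 * β) := by
        intro j hj
        have hle := S.min'_le j hj
        rw [Finset.mem_Icc]
        refine ⟨hle, key _ _ hle ?_ ?_⟩
        · have := (Finset.mem_filter.1 hj).1
          rw [Finset.mem_range] at this
          omega
        · rw [(Finset.mem_filter.1 hm).2, (Finset.mem_filter.1 hj).2]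
      have := Finset.card_le_card hsub
      rw [Nat.card_Icc] at this
      omega
    · rw [Finset.not_nonempty_iff_eq_empty.1 hne]; simp
  rw [Finset.card_range] at hcard
  have h6 : (2 * β + 1) * Z.card ≤ α * (2 * β + 1) := by
    rw [mul_comm]; exact Nat.mul_le_mul_right _ hZ
  rw [← hp]
  have : n ≤ α * (2 * β + 1) - 1 := by omega
  exact_mod_cast this

lemma edist_induce_aux {V : Type*} (G : SimpleGraph V) (C : G.ConnectedComponent)
    (x y : C.supp) :
    ∃ w : (G.induce C.supp).Walk x y, (w.length : ℕ∞) = G.edist x y := by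
  have hr : G.Reachable x y := by
    apply SimpleGraph.ConnectedComponent.exact
    rw [(SimpleGraph.ConnectedComponent.mem_supp_iff C _).1 x.2,
      (SimpleGraph.ConnectedComponent.mem_supp_iff C _).1 y.2]
  obtain ⟨p, hp⟩ := hr.exists_walk_length_eq_edist
  have hs : ∀ v ∈ p.support, v ∈ C.supp := by
    classical
    intro v hv
    rw [SimpleGraph.ConnectedComponent.mem_supp_iff,
      ← (SimpleGraph.ConnectedComponent.mem_supp_iff C _).1 x.2]
    exact SimpleGraph.ConnectedComponent.sound (p.takeUntil v hv).reachable.symm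
  refine ⟨p.induce C.supp hs, ?_⟩
  rw [← hp]
  have := congrArg SimpleGraph.Walk.length (SimpleGraph.Walk.map_induce p hs)
  rw [SimpleGraph.Walk.length_map] at this
  exact_mod_cast this

/-- If `G` is `(α, β)`-compact, then every connected component `H` of `G` (as an
induced subgraph) is `(α, β)`-compact, and any two vertices of `H` are at distance
at most `α(2β+1) - 1` in `H`; in particular `H` has diameter at most `α(2β+1) - 1`. -/
theorem stmt_8 {V : Type*} [Fintype V] (G : SimpleGraph V) (α β : ℕ) (hα : 1 ≤ α)
    (h : IsCompactGraph G α β) :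
    ∀ C : G.ConnectedComponent,
      IsCompactGraph (G.induce C.supp) α β ∧
      ∀ z z' : C.supp,
        (G.induce C.supp).edist z z' ≤ ((α * (2 * β + 1) - 1 : ℕ) : ℕ∞) := by
  classical
  intro C
  have hC : IsCompactGraph (G.induce C.supp) α β := by
    obtain ⟨Z, hZ, hc⟩ := h
    refine ⟨Z.subtype (· ∈ C.supp), ?_, ?_⟩
    · rw [Finset.card_subtype]
      exact (Finset.card_filter_le _ _).trans hZ
    · intro v
      obtain ⟨z, hz, hd⟩ := hc v
      have hr : G.Reachable z v := by
        apply SimpleGraph.reachable_of_edist_ne_top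
        intro ht
        rw [ht] at hd
        exact absurd hd (by simp)
      have hzC : z ∈ C.supp := by
        rw [SimpleGraph.ConnectedComponent.mem_supp_iff,
          ← (SimpleGraph.ConnectedComponent.mem_supp_iff C _).1 v.2]
        exact SimpleGraph.ConnectedComponent.sound hr
      refine ⟨⟨z, hzC⟩, by simpa using hz, ?_⟩
      obtain ⟨w, hw⟩ := edist_induce_aux G C ⟨z, hzC⟩ v
      exact (SimpleGraph.Walk.edist_le w).trans (hw.le.trans hd)
  refine ⟨hC, fun z z' => edist_bound_aux _ α β hC z z' ?_⟩
  obtain ⟨w, _⟩ := edist_induce_aux G C z z'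
  exact w.reachable
end

section
/- Let α, n ≥ 1 and β ≥ 0 be natural numbers, G a finite simple graph, and π(1),…,π(n) pairwise disjoint subsets of V(G) such that for each i the induced subgraph G[π(i)] is (α,β)-compact. Let U = π(1) ∪ … ∪ π(n). Then the induced subgraph G[U] is (nα, β)-compact, and every connected component of G[U] has diameter at most nα(2β+1) − 1. -/
theorem compact_diam {W : Type*} (H : SimpleGraph W) (a b : ℕ) (h : IsCompactGraph H a b)
    (z z' : W) (hr : H.Reachable z z') :
    H.edist z z' ≤ ((a * (2 * b + 1) - 1 : ℕ) : ℕ∞) := by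
  classical
  obtain ⟨Z, hZ, hc⟩ := h
  obtain ⟨p, hp⟩ := hr.exists_walk_length_eq_dist
  choose f hf hfd using hc
  have hlev : ∀ k ≤ p.length, H.dist z (p.getVert k) = k := by
    intro k hk
    have h1 : H.dist z (p.getVert k) ≤ k :=
      (SimpleGraph.dist_le (p.take k)).trans (by simp)
    have h2 : H.dist (p.getVert k) z' ≤ p.length - k :=
      (SimpleGraph.dist_le (p.drop k)).trans (by simp)
    have h3 : H.dist z z' ≤ H.dist z (p.getVert k) + H.dist (p.getVert k) z' :=
      SimpleGraph.Reachable.dist_triangle_left ⟨p.take k⟩ _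
    omega
  have hcard : (Finset.range (p.length + 1)).card ≤ (2 * b + 1) * Z.card := by
    apply Finset.card_le_mul_card_image_of_maps_to (f := fun k => f (p.getVert k))
    · intro k _
      exact hf _
    · intro c _
      have hsub : {k ∈ Finset.range (p.length + 1) | f (p.getVert k) = c} ⊆
          Finset.Icc (H.dist z c - b) (H.dist z c + b) := by
        intro k hk
        simp only [Finset.mem_filter, Finset.mem_range] at hk
        obtain ⟨hk, hkc⟩ := hk
        have hl := hlev k (by omega)
        have hd := hfd (p.getVert k)
        rw [hkc] at hd
        have hrc : H.Reachable c (p.getVert k) :=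
          SimpleGraph.reachable_of_edist_ne_top (ne_top_of_le_ne_top (ENat.coe_ne_top b) hd)
        have hrz : H.Reachable z (p.getVert k) := ⟨p.take k⟩
        have hd' : H.dist c (p.getVert k) ≤ b := by
          rw [← hrc.coe_dist_eq_edist] at hd
          exact_mod_cast hd
        have t1 : H.dist z (p.getVert k) ≤ H.dist z c + H.dist c (p.getVert k) :=
          SimpleGraph.Reachable.dist_triangle_left (hrz.trans hrc.symm) _
        have t2 : H.dist z c ≤ H.dist z (p.getVert k) + H.dist (p.getVert k) c :=
          SimpleGraph.Reachable.dist_triangle_left hrz _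
        rw [SimpleGraph.dist_comm (u := p.getVert k)] at t2
        rw [Finset.mem_Icc]
        omega
      refine (Finset.card_le_card hsub).trans ?_
      rw [Nat.card_Icc]
      omega
  rw [Finset.card_range] at hcard
  have h2 : (2 * b + 1) * Z.card ≤ a * (2 * b + 1) := by
    rw [mul_comm a]
    exact Nat.mul_le_mul_left _ hZ
  rw [← hr.coe_dist_eq_edist]
  exact_mod_cast (by omega : H.dist z z' ≤ a * (2 * b + 1) - 1)

theorem edist_hom_le {W X : Type*} {H : SimpleGraph W} {K : SimpleGraph X} (f : H →g K)
    (u v : W) : K.edist (f u) (f v) ≤ H.edist u v := by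
  by_cases h : H.Reachable u v
  · obtain ⟨p, hp⟩ := h.exists_walk_length_eq_edist
    rw [← hp, ← SimpleGraph.Walk.length_map f p]
    exact SimpleGraph.edist_le _
  · rw [SimpleGraph.edist_eq_top_of_not_reachable h]
    exact le_top

theorem compact_union {V : Type*} (G : SimpleGraph V) (α n β : ℕ) (π : Fin n → Set V)
    (hcomp : ∀ i, IsCompactGraph (G.induce (π i)) α β) :
    IsCompactGraph (G.induce (⋃ i, π i)) (n * α) β := by
  classical
  choose Z hZ hc using hcomp
  let φ : ∀ i, G.induce (π i) →g G.induce (⋃ i, π i) := fun i =>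
    (SimpleGraph.induceHomOfLE G (Set.subset_iUnion π i)).toHom
  refine ⟨Finset.univ.biUnion fun i => (Z i).image (φ i), ?_, ?_⟩
  · refine (Finset.card_biUnion_le_card_mul _ _ α ?_).trans (by simp)
    intro i _
    exact Finset.card_image_le.trans (hZ i)
  · rintro ⟨v, hv⟩
    obtain ⟨i, hi⟩ := Set.mem_iUnion.1 hv
    obtain ⟨c, hcZ, hd⟩ := hc i ⟨v, hi⟩
    refine ⟨φ i c, ?_, (edist_hom_le (φ i) c ⟨v, hi⟩).trans hd⟩
    simp only [Finset.mem_biUnion, Finset.mem_univ, true_and]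
    exact ⟨i, Finset.mem_image_of_mem _ hcZ⟩

/-- If `π 1, …, π n` are pairwise disjoint sets of vertices each inducing an
`(α, β)`-compact subgraph, then their union `U` induces an `(nα, β)`-compact subgraph,
and every connected component of `G[U]` has diameter at most `nα(2β+1) - 1` (i.e. any
two vertices of `G[U]` that are reachable from each other in `G[U]` are at distance at
most `nα(2β+1) - 1` in `G[U]`). -/
theorem stmt_9 {V : Type*} [Fintype V] (G : SimpleGraph V) (α n β : ℕ)
    (hα : 1 ≤ α) (hn : 1 ≤ n) (π : Fin n → Set V)
    (hdisj : ∀ i j, i ≠ j → Disjoint (π i) (π j))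
    (hcomp : ∀ i, IsCompactGraph (G.induce (π i)) α β) :
    IsCompactGraph (G.induce (⋃ i, π i)) (n * α) β ∧
    ∀ z z' : ↥(⋃ i, π i), (G.induce (⋃ i, π i)).Reachable z z' →
      (G.induce (⋃ i, π i)).edist z z' ≤ ((n * α * (2 * β + 1) - 1 : ℕ) : ℕ∞) := by
  have h := compact_union G α n β π hcomp
  exact ⟨h, fun z z' hr => compact_diam _ _ _ h z z' hr⟩
end

section
/- Let α, n ≥ 1 and β ≥ 0 be natural numbers, and let G be a finite simple graph with m ≥ 1 vertices in which every vertex has degree at most Δ. Set S = Σ_{j=0}^{β} Δ^j. Then the number of n-tuples (π(1),…,π(n)) of pairwise disjoint subsets of V(G) such that each induced subgraph G[π(i)] is (α,β)-compact is at most (m^α · 2^{α·S})^n. -/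
open Classical in
/-- Finset version of a ball of radius `k`, by recursion on the radius. -/
noncomputable def ballF {V : Type*} [Fintype V] (G : SimpleGraph V) [DecidableRel G.Adj] :
    ℕ → V → Finset V
  | 0, z => {z}
  | k + 1, z => insert z ((G.neighborFinset z).biUnion (ballF G k))

theorem ballF_card {V : Type*} [Fintype V] (G : SimpleGraph V) [DecidableRel G.Adj]
    (Δ : ℕ) (hdeg : ∀ v : V, G.degree v ≤ Δ) (k : ℕ) :
    ∀ z, (ballF G k z).card ≤ ∑ j ∈ Finset.range (k + 1), Δ ^ j := by
  classical
  induction k with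
  | zero => intro z; simp [ballF]
  | succ k ih =>
    intro z
    rw [ballF, Finset.sum_range_succ']
    refine (Finset.card_insert_le _ _).trans ?_
    have h1 := Finset.card_biUnion_le_card_mul (G.neighborFinset z) (ballF G k) _
      (fun y _ => ih y)
    rw [SimpleGraph.card_neighborFinset_eq_degree] at h1
    have h2 := h1.trans (Nat.mul_le_mul_right _ (hdeg z))
    rw [Finset.mul_sum] at h2
    simpa [pow_succ'] using h2

theorem mem_ballF {V : Type*} [Fintype V] (G : SimpleGraph V) [DecidableRel G.Adj]
    {z v : V} (p : G.Walk z v) : ∀ k, p.length ≤ k → v ∈ ballF G k z := by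
  classical
  induction p with
  | nil => intro k _; cases k <;> simp [ballF]
  | cons h p ih =>
    intro k hk
    cases k with
    | zero => simp at hk
    | succ k =>
      rw [ballF, Finset.mem_insert, Finset.mem_biUnion]
      exact Or.inr ⟨_, by simpa using h, ih k (by simpa using hk)⟩

theorem compact_subset {V : Type*} [Fintype V] [Nonempty V] (G : SimpleGraph V)
    [DecidableRel G.Adj] (α β : ℕ) (A : Set V)
    (hA : IsCompactGraph (G.induce A) α β) :
    ∃ f : Fin α → V, ∀ v ∈ A, ∃ i, v ∈ ballF G β (f i) := by
  classical
  obtain ⟨Z, hZ, hc⟩ := hA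
  let e := Z.equivFin
  refine ⟨fun i => if h : i.1 < Z.card then ((e.symm ⟨i.1, h⟩).1 : A).1
    else Classical.arbitrary V, ?_⟩
  intro v hv
  obtain ⟨z, hz, hd⟩ := hc ⟨v, hv⟩
  refine ⟨⟨(e ⟨z, hz⟩).1, (e ⟨z, hz⟩).2.trans_le hZ⟩, ?_⟩
  simp only [Fin.is_lt, dite_true, Fin.eta, Equiv.symm_apply_apply]
  obtain ⟨p, hp⟩ := SimpleGraph.exists_walk_of_edist_ne_top
    (ne_top_of_le_ne_top (ENat.coe_ne_top β) hd)
  rw [← hp] at hd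
  have hd' : p.length ≤ β := by exact_mod_cast hd
  exact mem_ballF G (p.map (SimpleGraph.Embedding.induce A).toHom) β
    ((SimpleGraph.Walk.length_map _ _).trans_le hd')

/-- Let `G` be a graph with `m ≥ 1` vertices and maximum degree at most `Δ`, and let
`S = ∑_{j=0}^{β} Δ^j`. The number of `n`-tuples of pairwise disjoint vertex subsets,
each inducing an `(α, β)`-compact subgraph, is at most `(m^α · 2^{α·S})^n`. -/
theorem stmt_12 {V : Type*} [Fintype V] (G : SimpleGraph V) [DecidableRel G.Adj]
    (α n β Δ : ℕ) (hα : 1 ≤ α) (hn : 1 ≤ n) (hm : 1 ≤ Fintype.card V)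
    (hdeg : ∀ v : V, G.degree v ≤ Δ) :
    Set.ncard {π : Fin n → Set V |
        (∀ i j, i ≠ j → Disjoint (π i) (π j)) ∧
        ∀ i, IsCompactGraph (G.induce (π i)) α β} ≤
      (Fintype.card V ^ α * 2 ^ (α * ∑ j ∈ Finset.range (β + 1), Δ ^ j)) ^ n := by
  classical
  haveI : Nonempty V := Fintype.card_pos_iff.mp hm
  set S := ∑ j ∈ Finset.range (β + 1), Δ ^ j with hS
  let U : (Fin α → V) → Finset V := fun f => Finset.univ.biUnion fun i => ballF G β (f i)
  have hU : ∀ f, (U f).card ≤ α * S := fun f => by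
    simpa using Finset.card_biUnion_le_card_mul Finset.univ (fun i => ballF G β (f i)) S
      (fun i _ => ballF_card G Δ hdeg β (f i))
  let C : Finset (Set V) := Finset.univ.biUnion fun f : Fin α → V =>
    (U f).powerset.image (fun s : Finset V => (s : Set V))
  have hC : C.card ≤ Fintype.card V ^ α * 2 ^ (α * S) := by
    have h := Finset.card_biUnion_le_card_mul (Finset.univ : Finset (Fin α → V))
      (fun f => (U f).powerset.image (fun s : Finset V => (s : Set V))) (2 ^ (α * S))
      (fun f _ => Finset.card_image_le.trans (by
        rw [Finset.card_powerset]
        exact Nat.pow_le_pow_right (by norm_num) (hU f)))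
    simpa using h
  have hsub : {π : Fin n → Set V |
        (∀ i j, i ≠ j → Disjoint (π i) (π j)) ∧
        ∀ i, IsCompactGraph (G.induce (π i)) α β} ⊆
      ((Fintype.piFinset fun _ : Fin n => C : Finset (Fin n → Set V)) : Set _) := by
    rintro π ⟨-, hπ⟩
    rw [Finset.mem_coe, Fintype.mem_piFinset]
    intro i
    obtain ⟨f, hf⟩ := compact_subset G α β (π i) (hπ i)
    refine Finset.mem_biUnion.mpr ⟨f, Finset.mem_univ _, Finset.mem_image.mpr
      ⟨(π i).toFinset, Finset.mem_powerset.mpr ?_, by simp⟩⟩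
    intro v hv
    obtain ⟨j, hj⟩ := hf v (by simpa using hv)
    exact Finset.mem_biUnion.mpr ⟨j, Finset.mem_univ _, hj⟩
  refine (Set.ncard_le_ncard hsub (Finset.finite_toSet _)).trans ?_
  rw [Set.ncard_coe_finset, Fintype.card_piFinset]
  simpa using Nat.pow_le_pow_left hC n
end

section
/- Let α, s ≥ 1 and r > s be natural numbers, X a finite set with |X| = αs, and F_1,…,F_r subsets of X each of size α. Define the item set Z = {w_x : x ∈ X} ∪ {y_1,…,y_{r−s}} ∪ {y_*} (all items distinct) and, for agents 1,…,r+1, additive valuations: for i ∈ {1,…,r}: v_i(w_x) = 1/(αr+α) if x ∈ F_i and 0 otherwise, v_i(y_j) = 1/(r+1) for each j ∈ {1,…,r−s}, and v_i(y_*) = s/(r+1); for agent r+1: v_{r+1}(w_x) = 0 for all x, v_{r+1}(y_j) = 0 for all j, and v_{r+1}(y_*) = 1. Then {F_1,…,F_r} has an exact cover of X if and only if there exists a function π : {1,…,r+1} → 2^Z with pairwise disjoint values such that |π(i)| ≤ α and Σ_{z∈π(i)} v_i(z) ≥ 1/(r+1) for every agent i. (This is the correctness of the reduction from Exact Cover by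 α-Sets proving strong NP-hardness of proportional (α,β)-compact fair division on edgeless graphs.) -/
/-- The valuations in the reduction from Exact Cover by α-Sets for proportionality:
items are `Sum.inl x` (the item `w_x` for `x ∈ X`), `Sum.inr (Sum.inl j)` (the
auxiliary item `y_j`, `j ∈ {1,…,r-s}`), and `Sum.inr (Sum.inr ())` (the special item
`y_*`). Agents `i` with `i < r` correspond to the sets `F_i`; agent `r` (the last of
the `r + 1` agents) is the dummy agent. -/
def propVal {X : Type*} [DecidableEq X] (α s r : ℕ) (F : Fin r → Finset X)
    (i : Fin (r + 1)) (z : X ⊕ (Fin (r - s) ⊕ Unit)) : ℚ :=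
  if h : (i : ℕ) < r then
    match z with
    | Sum.inl x => if x ∈ F ⟨(i : ℕ), h⟩ then 1 / ((α : ℚ) * r + α) else 0
    | Sum.inr (Sum.inl _) => 1 / ((r : ℚ) + 1)
    | Sum.inr (Sum.inr _) => (s : ℚ) / ((r : ℚ) + 1)
  else
    match z with
    | Sum.inl _ => 0
    | Sum.inr (Sum.inl _) => 0
    | Sum.inr (Sum.inr _) => 1

theorem propVal_castSucc {X : Type*} [DecidableEq X] (α s r : ℕ) (F : Fin r → Finset X)
    (i : Fin r) (z : X ⊕ (Fin (r - s) ⊕ Unit)) :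
    propVal α s r F i.castSucc z =
    match z with
    | Sum.inl x => if x ∈ F i then 1 / ((α : ℚ) * r + α) else 0
    | Sum.inr (Sum.inl _) => 1 / ((r : ℚ) + 1)
    | Sum.inr (Sum.inr _) => (s : ℚ) / ((r : ℚ) + 1) := by
  have h : ((i.castSucc : Fin (r+1)) : ℕ) < r := by simp
  unfold propVal
  rw [dif_pos h]
  rfl

theorem propVal_last {X : Type*} [DecidableEq X] (α s r : ℕ) (F : Fin r → Finset X)
    (z : X ⊕ (Fin (r - s) ⊕ Unit)) :
    propVal α s r F (Fin.last r) z =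
    match z with
    | Sum.inl _ => 0
    | Sum.inr (Sum.inl _) => 0
    | Sum.inr (Sum.inr _) => 1 := by
  have h : ¬ ((Fin.last r : Fin (r+1)) : ℕ) < r := by simp
  unfold propVal
  rw [dif_neg h]

/-- Correctness of the reduction from Exact Cover by α-Sets (X-α-C) for proportional
`(α, β)`-compact fair division on edgeless graphs: the family `F_1, …, F_r` of α-sized
subsets of `X` (with `|X| = α·s`) has an exact cover iff there is an allocation of the
items to the `r + 1` agents in which every bundle has at most `α` items (compactness on
an edgeless graph) and every agent receives value at least `1/(r+1)` (proportionality). -/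
theorem stmt_15 (α s r : ℕ) (hα : 1 ≤ α) (hs : 1 ≤ s) (hr : s < r)
    {X : Type*} [Fintype X] [DecidableEq X] (hX : Fintype.card X = α * s)
    (F : Fin r → Finset X) (hF : ∀ i, (F i).card = α) :
    (∃ I : Finset (Fin r),
      (∀ i ∈ I, ∀ j ∈ I, i ≠ j → Disjoint (F i) (F j)) ∧
      I.biUnion F = Finset.univ) ↔
    (∃ π : Fin (r + 1) → Finset (X ⊕ (Fin (r - s) ⊕ Unit)),
      (∀ i j, i ≠ j → Disjoint (π i) (π j)) ∧
      (∀ i, (π i).card ≤ α) ∧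
      (∀ i, 1 / ((r : ℚ) + 1) ≤ ∑ z ∈ π i, propVal α s r F i z)) := by
  have hαq : (0:ℚ) < α := by exact_mod_cast hα
  have hrq : (0:ℚ) < (r:ℚ) + 1 := by positivity
  have hmul : (α:ℚ) * (1 / ((α : ℚ) * r + α)) = 1 / ((r:ℚ) + 1) := by
    have : (α : ℚ) * r + α ≠ 0 := by positivity
    field_simp
  constructor
  · rintro ⟨I, hd, hU⟩
    have hI : I.card = s := by
      have h1 := Finset.card_biUnion (s := I) (t := F) hd
      rw [hU, Finset.card_univ, hX, Finset.sum_congr rfl (fun i _ => hF i)] at h1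
      simp only [Finset.sum_const, smul_eq_mul] at h1
      have : α * s = α * I.card := by rw [h1, mul_comm]
      exact (Nat.eq_of_mul_eq_mul_left hα this).symm
    obtain ⟨g, hg⟩ : ∃ g : Fin r → Fin (r - s), ∀ i ∉ I, ∀ j ∉ I, g i = g j → i = j := by
      have hc : Fintype.card {i // i ∉ I} = r - s := by
        simp [Fintype.card_subtype_compl, hI]
      let e := Fintype.equivFinOfCardEq hc
      refine ⟨fun i => if h : i ∉ I then e ⟨i, h⟩ else ⟨0, by omega⟩, ?_⟩
      intro i hi j hj h
      simp only [hi, hj, not_false_eq_true, dite_true] at h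
      simpa using e.injective h
    let f : Fin r → Finset (X ⊕ (Fin (r - s) ⊕ Unit)) := fun i =>
      if i ∈ I then (F i).map Function.Embedding.inl else {Sum.inr (Sum.inl (g i))}
    have hfl : ∀ i, Disjoint (f i) {Sum.inr (Sum.inr ())} := by
      intro i
      simp only [f]
      split_ifs <;> simp
    refine ⟨Fin.snoc (α := fun _ => Finset (X ⊕ (Fin (r - s) ⊕ Unit))) f
      {Sum.inr (Sum.inr ())}, ?_, ?_, ?_⟩
    · intro i j
      refine Fin.lastCases ?_ (fun i => ?_) i <;> refine Fin.lastCases ?_ (fun j => ?_) j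
      · simp
      · intro _
        simp only [Fin.snoc_last, Fin.snoc_castSucc]
        exact (hfl j).symm
      · intro _
        simp only [Fin.snoc_last, Fin.snoc_castSucc]
        exact hfl i
      · intro hij
        have hij : i ≠ j := fun h => hij (by rw [h])
        simp only [Fin.snoc_castSucc, f]
        split_ifs with h1 h2 h2
        · rw [Finset.disjoint_map]
          exact hd i h1 j h2 hij
        · simp
        · simp
        · simp only [Finset.disjoint_singleton, ne_eq, Sum.inr.injEq, Sum.inl.injEq]
          exact fun h => hij (hg i h1 j h2 h)
    · intro i
      refine Fin.lastCases ?_ (fun i => ?_) i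
      · simpa using hα
      · simp only [Fin.snoc_castSucc, f]
        split_ifs
        · simp [hF]
        · simpa using hα
    · intro i
      refine Fin.lastCases ?_ (fun i => ?_) i
      · simp only [Fin.snoc_last, Finset.sum_singleton, propVal_last]
        rw [div_le_one hrq]
        have : (0:ℚ) ≤ r := by positivity
        linarith
      · simp only [Fin.snoc_castSucc, f]
        split_ifs
        · simp only [Finset.sum_map, propVal_castSucc, Function.Embedding.inl_apply]
          rw [Finset.sum_congr rfl (fun x hx => if_pos hx), Finset.sum_const, hF, nsmul_eq_mul,
            hmul]
        · simp [propVal_castSucc]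
  · rintro ⟨π, hd, hc, hv⟩
    have hpos : (0:ℚ) < 1 / ((r:ℚ) + 1) := by positivity
    have hstar : Sum.inr (Sum.inr ()) ∈ π (Fin.last r) := by
      by_contra hn
      have h0 : ∑ z ∈ π (Fin.last r), propVal α s r F (Fin.last r) z = 0 := by
        apply Finset.sum_eq_zero
        intro z hz
        rw [propVal_last]
        rcases z with x | j | u
        · rfl
        · rfl
        · exact absurd hz hn
      have := hv (Fin.last r)
      rw [h0] at this
      linarith
    have hns : ∀ i : Fin r, Sum.inr (Sum.inr ()) ∉ π i.castSucc := fun i hi =>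
      Finset.disjoint_left.1 (hd _ _ (Fin.castSucc_lt_last i).ne) hi hstar
    classical
    let J : Finset (Fin r) := Finset.univ.filter fun i => ∃ j, Sum.inr (Sum.inl j) ∈ π i.castSucc
    have hJ : J.card ≤ r - s := by
      have h1 : ∀ i : J, ∃ j, Sum.inr (Sum.inl j) ∈ π i.1.castSucc := fun i =>
        (Finset.mem_filter.1 i.2).2
      choose g hg using h1
      have hgi : Function.Injective g := by
        intro a b hab
        by_contra hne
        have h2 : a.1.castSucc ≠ b.1.castSucc := fun h =>
          hne (Subtype.ext (Fin.castSucc_injective _ h))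
        have h3 := hg b
        rw [← hab] at h3
        exact Finset.disjoint_left.1 (hd _ _ h2) (hg a) h3
      simpa using Fintype.card_le_of_injective g hgi
    have hJc : s ≤ Jᶜ.card := by
      rw [Finset.card_compl, Fintype.card_fin]
      omega
    have key : ∀ i ∈ Jᶜ, (F i).map Function.Embedding.inl ⊆ π i.castSucc := by
      intro i hi
      have hny : ∀ j, Sum.inr (Sum.inl j) ∉ π i.castSucc := by
        simpa [J] using hi
      let T := (F i).filter fun x => Sum.inl x ∈ π i.castSucc
      have hsum : ∑ z ∈ π i.castSucc, propVal α s r F i.castSucc z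
          = T.card * (1 / ((α : ℚ) * r + α)) := by
        have hsub : T.map Function.Embedding.inl ⊆ π i.castSucc := by
          intro z hz
          obtain ⟨x, hx, rfl⟩ := Finset.mem_map.1 hz
          exact (Finset.mem_filter.1 hx).2
        rw [← Finset.sum_subset hsub]
        · simp only [Finset.sum_map, propVal_castSucc, Function.Embedding.inl_apply]
          rw [Finset.sum_congr rfl (fun x hx => if_pos (Finset.mem_filter.1 hx).1),
            Finset.sum_const, nsmul_eq_mul]
        · intro z hz hzn
          rw [propVal_castSucc]
          rcases z with x | j | u
          · refine if_neg fun hx => hzn ?_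
            exact Finset.mem_map.2 ⟨x, Finset.mem_filter.2 ⟨hx, hz⟩, rfl⟩
          · exact absurd hz (hny j)
          · exact absurd hz (hns i)
      have h := hv i.castSucc
      rw [hsum, ← hmul] at h
      have hp : (0:ℚ) < 1 / ((α : ℚ) * r + α) := by positivity
      have hle : α ≤ T.card := by exact_mod_cast le_of_mul_le_mul_right h hp
      have hT : T = F i := Finset.eq_of_subset_of_card_le (Finset.filter_subset _ _)
        (by rw [hF]; exact hle)
      intro z hz
      obtain ⟨x, hx, rfl⟩ := Finset.mem_map.1 hz
      rw [← hT] at hx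
      exact (Finset.mem_filter.1 hx).2
    have hdis : ∀ i ∈ Jᶜ, ∀ j ∈ Jᶜ, i ≠ j → Disjoint (F i) (F j) := by
      intro i hi j hj hij
      rw [← Finset.disjoint_map Function.Embedding.inl]
      exact Finset.disjoint_of_subset_left (key i hi) (Finset.disjoint_of_subset_right (key j hj)
        (hd _ _ fun h => hij (Fin.castSucc_injective _ h)))
    refine ⟨Jᶜ, hdis, ?_⟩
    apply Finset.eq_univ_of_card
    apply le_antisymm (Finset.card_le_univ _)
    rw [Finset.card_biUnion hdis, Finset.sum_congr rfl (fun i _ => hF i), hX, Finset.sum_const,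
      smul_eq_mul, mul_comm]
    exact Nat.mul_le_mul_right _ hJc
end

section
/- Let α, s ≥ 1 and r > s be natural numbers, X a finite set with |X| = αs, and F_1,…,F_r subsets of X each of size α. Define the item set Z = {w_x : x ∈ X} ∪ {y_1,…,y_{r−s}} (all items distinct) and, for agents 1,…,r, additive valuations: v_i(w_x) = 1/(αr−αs+α) if x ∈ F_i and 0 otherwise, and v_i(y_j) = 1/(r−s+1) for each j ∈ {1,…,r−s}. Then {F_1,…,F_r} has an exact cover of X if and only if there exists a function π : {1,…,r} → 2^Z with pairwise disjoint values such that π(1) ∪ … ∪ π(r) = Z, |π(i)| ≤ α for every i, and v_i(π(i)) ≥ v_i(π(j)) for all agents i, j. (This is the correctness of the reduction from Exact Cover by α-Sets proving strong NP-hardness of complete envy-free (α,β)-compact fair division on edgeless graphs.) -/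
/-- The valuations in the reduction from Exact Cover by α-Sets for complete envy-free
fair division: items are `Sum.inl x` (the item `w_x` for `x ∈ X`) and `Sum.inr j`
(the auxiliary item `y_j`, `j ∈ {1,…,r-s}`); agent `i ∈ {1,…,r}` corresponds to the
set `F_i`. -/
def efVal {X : Type*} [DecidableEq X] (α s r : ℕ) (F : Fin r → Finset X)
    (i : Fin r) (z : X ⊕ Fin (r - s)) : ℚ :=
  match z with
  | Sum.inl x => if x ∈ F i then 1 / ((α * r - α * s + α : ℕ) : ℚ) else 0
  | Sum.inr _ => 1 / ((r - s + 1 : ℕ) : ℚ)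

/-- Integer-scaled valuations. -/
def efU {X : Type*} [DecidableEq X] (α s r : ℕ) (F : Fin r → Finset X)
    (i : Fin r) (z : X ⊕ Fin (r - s)) : ℕ :=
  match z with
  | Sum.inl x => if x ∈ F i then 1 else 0
  | Sum.inr _ => α

lemma efVal_eq {X : Type*} [DecidableEq X] (α s r : ℕ) (hα : 1 ≤ α) (F : Fin r → Finset X)
    (i : Fin r) (z : X ⊕ Fin (r - s)) :
    efVal α s r F i z = (1 / ((α * r - α * s + α : ℕ) : ℚ)) * (efU α s r F i z : ℚ) := by
  have h : α * r - α * s + α = α * (r - s + 1) := by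
    rw [← Nat.mul_sub]; ring
  rcases z with x | j
  · simp only [efVal, efU]
    split_ifs <;> simp
  · simp only [efVal, efU]
    rw [h]
    have : (α : ℚ) ≠ 0 := by positivity
    have h2 : ((r - s + 1 : ℕ) : ℚ) ≠ 0 := by positivity
    rw [Nat.cast_mul]
    field_simp

lemma efVal_le_iff {X : Type*} [DecidableEq X] (α s r : ℕ) (hα : 1 ≤ α) (F : Fin r → Finset X)
    (i : Fin r) (S T : Finset (X ⊕ Fin (r - s))) :
    (∑ z ∈ S, efVal α s r F i z ≤ ∑ z ∈ T, efVal α s r F i z) ↔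
      ∑ z ∈ S, efU α s r F i z ≤ ∑ z ∈ T, efU α s r F i z := by
  simp only [efVal_eq α s r hα, ← Finset.mul_sum]
  have hc : (0 : ℚ) < 1 / ((α * r - α * s + α : ℕ) : ℚ) := by positivity
  rw [mul_le_mul_iff_right₀ hc]
  exact_mod_cast Iff.rfl

/-- Correctness of the reduction from Exact Cover by α-Sets (X-α-C) for complete
envy-free `(α, β)`-compact fair division on edgeless graphs: the family `F_1, …, F_r`
of α-sized subsets of `X` (with `|X| = α·s`) has an exact cover iff there is a
complete allocation of the items to the `r` agents in which every bundle has at most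
`α` items (compactness on an edgeless graph) and no agent envies another. -/
theorem stmt_16 (α s r : ℕ) (hα : 1 ≤ α) (hs : 1 ≤ s) (hr : s < r)
    {X : Type*} [Fintype X] [DecidableEq X] (hX : Fintype.card X = α * s)
    (F : Fin r → Finset X) (hF : ∀ i, (F i).card = α) :
    (∃ I : Finset (Fin r),
      (∀ i ∈ I, ∀ j ∈ I, i ≠ j → Disjoint (F i) (F j)) ∧
      I.biUnion F = Finset.univ) ↔
    (∃ π : Fin r → Finset (X ⊕ Fin (r - s)),
      (∀ i j, i ≠ j → Disjoint (π i) (π j)) ∧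
      (∀ z, ∃ i, z ∈ π i) ∧
      (∀ i, (π i).card ≤ α) ∧
      (∀ i j, ∑ z ∈ π j, efVal α s r F i z ≤ ∑ z ∈ π i, efVal α s r F i z)) := by
  simp only [efVal_le_iff α s r hα]
  constructor
  · rintro ⟨I, hd, hU⟩
    have hIc : I.card = s := by
      have h1 : (I.biUnion F).card = ∑ i ∈ I, (F i).card :=
        Finset.card_biUnion (fun i hi j hj hij => hd i hi j hj hij)
      rw [hU, Finset.card_univ, hX] at h1
      simp only [hF, Finset.sum_const, smul_eq_mul] at h1
      rw [mul_comm I.card] at h1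
      exact (Nat.eq_of_mul_eq_mul_left hα h1).symm
    have hcc : Fintype.card {i // i ∈ Iᶜ} = Fintype.card (Fin (r - s)) := by
      rw [Fintype.card_coe, Finset.card_compl, hIc]; simp
    let e := Fintype.equivOfCardEq hcc
    let π : Fin r → Finset (X ⊕ Fin (r - s)) := fun i =>
      if h : i ∈ Iᶜ then {Sum.inr (e ⟨i, h⟩)} else (F i).map Function.Embedding.inl
    have hπ1 : ∀ i, i ∈ I → π i = (F i).map Function.Embedding.inl := by
      intro i hi
      simp [π, hi]
    have hπ2 : ∀ i (h : i ∈ Iᶜ), π i = {Sum.inr (e ⟨i, h⟩)} := by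
      intro i h
      simp only [π, dif_pos h]
    have key : ∀ i j, ∑ z ∈ π j, efU α s r F i z ≤ α := by
      intro i j
      by_cases hj : j ∈ I
      · rw [hπ1 j hj, Finset.sum_map]
        calc _ ≤ ∑ x ∈ F j, 1 := by
              apply Finset.sum_le_sum
              intro x _
              simp only [efU, Function.Embedding.inl_apply]
              split_ifs <;> simp
          _ = α := by simp [hF]
      · rw [hπ2 j (by simpa using hj)]
        simp [efU]
    refine ⟨π, ?_, ?_, ?_, ?_⟩
    · intro i j hij
      rw [Finset.disjoint_left]
      intro z hz hz'
      by_cases hi : i ∈ I <;> by_cases hj : j ∈ I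
      · rw [hπ1 i hi, Finset.mem_map] at hz
        rw [hπ1 j hj, Finset.mem_map] at hz'
        obtain ⟨x, hx, rfl⟩ := hz
        obtain ⟨y, hy, hxy⟩ := hz'
        have : y = x := Function.Embedding.inl.injective hxy
        subst this
        exact Finset.disjoint_left.1 (hd i hi j hj hij) hx hy
      · rw [hπ1 i hi] at hz
        rw [hπ2 j (by simpa using hj), Finset.mem_singleton] at hz'
        subst hz'
        simp at hz
      · rw [hπ1 j hj] at hz'
        rw [hπ2 i (by simpa using hi), Finset.mem_singleton] at hz
        subst hz
        simp at hz'
      · rw [hπ2 i (by simpa using hi), Finset.mem_singleton] at hz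
        rw [hπ2 j (by simpa using hj), Finset.mem_singleton] at hz'
        rw [hz] at hz'
        have := e.injective (Sum.inr_injective hz')
        exact hij (congrArg Subtype.val this)
    · rintro (x | j)
      · have : x ∈ I.biUnion F := by rw [hU]; exact Finset.mem_univ x
        obtain ⟨i, hi, hx⟩ := Finset.mem_biUnion.1 this
        refine ⟨i, ?_⟩
        rw [hπ1 i hi]
        simpa using hx
      · refine ⟨(e.symm j).1, ?_⟩
        rw [hπ2 _ (e.symm j).2]
        simp
    · intro i
      by_cases hi : i ∈ I
      · rw [hπ1 i hi]; simp [hF]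
      · rw [hπ2 i (by simpa using hi)]; simpa using hα
    · intro i j
      refine (key i j).trans (le_of_eq ?_)
      by_cases hi : i ∈ I
      · rw [hπ1 i hi, Finset.sum_map]
        have : ∀ x ∈ F i, efU α s r F i (Function.Embedding.inl x) = 1 := by
          intro x hx
          simp [efU, hx]
        rw [Finset.sum_congr rfl this]
        simp [hF]
      · rw [hπ2 i (by simpa using hi)]
        simp [efU]
  · rintro ⟨π, hd, hc, hcard, hef⟩
    have hlow : ∀ i, α ≤ ∑ z ∈ π i, efU α s r F i z := by
      intro i
      obtain ⟨j, hj⟩ := hc (Sum.inr ⟨0, by omega⟩)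
      refine le_trans ?_ (hef i j)
      exact Finset.single_le_sum (f := efU α s r F i) (fun _ _ => Nat.zero_le _) hj
    choose o ho using fun j : Fin (r - s) => hc (Sum.inr j)
    let H : Finset (Fin r) := Finset.univ.image o
    have hHc : H.card ≤ r - s := by
      simpa using (Finset.card_image_le (s := Finset.univ) (f := o))
    have hno : ∀ i, i ∈ Hᶜ → ∀ j, Sum.inr j ∉ π i := by
      intro i hi j hj
      have : o j ≠ i := by
        rintro rfl
        simp [H] at hi
      exact Finset.disjoint_left.1 (hd _ _ this) (ho j) hj
    have hsub : ∀ i, i ∈ Hᶜ → ∀ x ∈ F i, Sum.inl x ∈ π i := by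
      intro i hi
      have h1 : ∑ z ∈ π i, efU α s r F i z ≤ ((F i).filter (fun x => Sum.inl x ∈ π i)).card := by
        have hz : ∀ z ∈ π i, efU α s r F i z =
            if z ∈ (F i).map Function.Embedding.inl then 1 else 0 := by
          rintro (x | j) hz
          · simp [efU]
          · exact absurd hz (hno i hi j)
        rw [Finset.sum_congr rfl hz, Finset.sum_boole, Nat.cast_id]
        rw [← Finset.card_map (Function.Embedding.inl : X ↪ X ⊕ Fin (r - s))]
        apply Finset.card_le_card
        intro z hz
        simp only [Finset.mem_filter, Finset.mem_map] at hz ⊢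
        obtain ⟨hz1, x, hx, rfl⟩ := hz
        exact ⟨x, ⟨hx, hz1⟩, rfl⟩
      have h2 := (hlow i).trans h1
      have h3 : (F i).filter (fun x => Sum.inl x ∈ π i) = F i :=
        Finset.eq_of_subset_of_card_le (Finset.filter_subset _ _) (by rw [hF]; exact h2)
      intro x hx
      rw [← h3] at hx
      exact (Finset.mem_filter.1 hx).2
    have hdis : ∀ i ∈ Hᶜ, ∀ j ∈ Hᶜ, i ≠ j → Disjoint (F i) (F j) := by
      intro i hi j hj hij
      rw [Finset.disjoint_left]
      intro x hx hx'
      exact Finset.disjoint_left.1 (hd i j hij) (hsub i hi x hx) (hsub j hj x hx')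
    refine ⟨Hᶜ, hdis, ?_⟩
    apply Finset.eq_univ_of_card
    apply le_antisymm (Finset.card_le_univ _)
    rw [Finset.card_biUnion (fun i hi j hj hij => hdis i hi j hj hij), hX]
    simp only [hF, Finset.sum_const, smul_eq_mul]
    rw [mul_comm]
    apply Nat.mul_le_mul_right
    rw [Finset.card_compl, Fintype.card_fin]
    omega
end

section
/- Let α, s ≥ 1 and r > s be natural numbers, X a finite set with |X| = αs, and F_1,…,F_r subsets of X each of size α. Define the item set Z = {w_x : x ∈ X} ∪ {y_1,…,y_{r−s}} and, for agents 1,…,r, additive valuations v_i(w_x) = 1/(αr−αs+α) if x ∈ F_i and 0 otherwise, and v_i(y_j) = 1/(r−s+1) for each j. Then: (a) for every function π : {1,…,r} → 2^Z with pairwise disjoint values, the utilitarian social welfare satisfies Σ_{i=1}^{r} v_i(π(i)) ≤ r/(r−s+1); and (b) if {F_1,…,F_r} has an exact cover of X, then there is such a π that is complete (π(1) ∪ … ∪ π(r) = Z), has |π(i)| ≤ α for all i, and attains Σ_{i=1}^{r} v_i(π(i)) = r/(r−s+1). -/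
theorem efVal_total {X : Type*} [Fintype X] (α s r : ℕ) (hα : 1 ≤ α) (hr : s < r)
    (hX : Fintype.card X = α * s) :
    ∑ z : X ⊕ Fin (r - s), (Sum.elim (fun _ => 1 / ((α * r - α * s + α : ℕ) : ℚ))
      (fun _ => 1 / ((r - s + 1 : ℕ) : ℚ)) z : ℚ) = (r : ℚ) / ((r - s + 1 : ℕ) : ℚ) := by
  obtain ⟨k, rfl⟩ := Nat.exists_eq_add_of_lt hr
  have h1 : α * (s + k + 1) - α * s + α = α * (k + 2) := by
    rw [← Nat.mul_sub, show s + k + 1 - s = k + 1 by omega]; ring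
  have h2 : s + k + 1 - s = k + 1 := by omega
  have hα' : (α : ℚ) ≠ 0 := by positivity
  have hk : (k : ℚ) + 1 + 1 ≠ 0 := by positivity
  have hk2 : (k : ℚ) + 2 ≠ 0 := by positivity
  simp only [Fintype.sum_sum_type, Sum.elim_inl, Sum.elim_inr, Finset.sum_const,
    Finset.card_univ, hX, Fintype.card_fin, h1, nsmul_eq_mul, h2]
  push_cast
  field_simp
  ring

/-- In the Exact Cover by α-Sets reduction instance: (a) every allocation (pairwise
disjoint bundles) has utilitarian social welfare at most `r/(r-s+1)`; and (b) if
`F_1, …, F_r` has an exact cover of `X`, then there is a complete allocation with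
bundles of size at most `α` attaining social welfare exactly `r/(r-s+1)`. -/
theorem stmt_17 (α s r : ℕ) (hα : 1 ≤ α) (hs : 1 ≤ s) (hr : s < r)
    {X : Type*} [Fintype X] [DecidableEq X] (hX : Fintype.card X = α * s)
    (F : Fin r → Finset X) (hF : ∀ i, (F i).card = α) :
    (∀ π : Fin r → Finset (X ⊕ Fin (r - s)),
      (∀ i j, i ≠ j → Disjoint (π i) (π j)) →
      ∑ i, ∑ z ∈ π i, efVal α s r F i z ≤ (r : ℚ) / ((r - s + 1 : ℕ) : ℚ)) ∧
    ((∃ I : Finset (Fin r),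
        (∀ i ∈ I, ∀ j ∈ I, i ≠ j → Disjoint (F i) (F j)) ∧
        I.biUnion F = Finset.univ) →
      ∃ π : Fin r → Finset (X ⊕ Fin (r - s)),
        (∀ i j, i ≠ j → Disjoint (π i) (π j)) ∧
        (∀ z, ∃ i, z ∈ π i) ∧
        (∀ i, (π i).card ≤ α) ∧
        ∑ i, ∑ z ∈ π i, efVal α s r F i z = (r : ℚ) / ((r - s + 1 : ℕ) : ℚ)) := by
  have htot := efVal_total (X := X) α s r hα hr hX
  set u : X ⊕ Fin (r - s) → ℚ := Sum.elim (fun _ => 1 / ((α * r - α * s + α : ℕ) : ℚ))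
      (fun _ => 1 / ((r - s + 1 : ℕ) : ℚ)) with hu
  constructor
  · intro π hπ
    have hle : ∀ i z, efVal α s r F i z ≤ u z := by
      rintro i (x | j)
      · simp only [efVal, hu, Sum.elim_inl]
        split_ifs
        · exact le_rfl
        · positivity
      · simp [efVal, hu]
    have hu0 : ∀ z, 0 ≤ u z := by
      rintro (x | j)
      · simp only [hu, Sum.elim_inl]; positivity
      · simp only [hu, Sum.elim_inr]; positivity
    rw [← htot]
    calc ∑ i, ∑ z ∈ π i, efVal α s r F i z ≤ ∑ i, ∑ z ∈ π i, u z :=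
          Finset.sum_le_sum fun i _ => Finset.sum_le_sum fun z _ => hle i z
      _ = ∑ z ∈ Finset.univ.biUnion π, u z := by
          rw [Finset.sum_biUnion]
          intro i _ j _ hij
          exact hπ i j hij
      _ ≤ ∑ z, u z := Finset.sum_le_sum_of_subset_of_nonneg (Finset.subset_univ _)
          fun z _ _ => hu0 z
  · rintro ⟨I, hI, hcov⟩
    have hcard : I.card = s := by
      have h := Finset.card_biUnion (s := I) (t := F) hI
      rw [hcov, Finset.card_univ, hX, Finset.sum_congr rfl (fun i _ => hF i),
        Finset.sum_const, smul_eq_mul, mul_comm] at h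
      exact (Nat.eq_of_mul_eq_mul_right hα h).symm
    have hcomp : Fintype.card {i // i ∈ Iᶜ} = Fintype.card (Fin (r - s)) := by
      simp [Finset.card_compl, hcard]
    let e := Fintype.equivOfCardEq hcomp
    have hex : ∀ x : X, ∃ i, i ∈ I ∧ x ∈ F i := by
      intro x
      have : x ∈ I.biUnion F := by rw [hcov]; exact Finset.mem_univ x
      simpa using this
    choose f hfI hfF using hex
    let g : X ⊕ Fin (r - s) → Fin r := Sum.elim f (fun j => (e.symm j).1)
    refine ⟨fun i => Finset.univ.filter (fun z => g z = i), ?_, ?_, ?_, ?_⟩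
    · intro i j hij
      rw [Finset.disjoint_left]
      intro z hz hz'
      simp only [Finset.mem_filter, Finset.mem_univ, true_and] at hz hz'
      exact hij (hz.symm.trans hz')
    · intro z
      exact ⟨g z, by simp⟩
    · intro i
      by_cases hi : i ∈ I
      · rw [← hF i, ← Finset.card_map (s := F i) (Function.Embedding.inl (β := Fin (r - s)))]
        apply Finset.card_le_card
        rintro (x | j) hz
        · simp only [g, Finset.mem_filter, Finset.mem_univ, true_and, Sum.elim_inl] at hz
          exact Finset.mem_map.2 ⟨x, hz ▸ hfF x, rfl⟩
        · simp only [g, Finset.mem_filter, Finset.mem_univ, true_and, Sum.elim_inr] at hz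
          exact absurd (hz ▸ hi) (Finset.mem_compl.1 (e.symm j).2)
      · refine le_trans ?_ hα
        rw [← Finset.card_singleton (Sum.inr (e ⟨i, Finset.mem_compl.2 hi⟩) : X ⊕ Fin (r - s))]
        apply Finset.card_le_card
        rintro (x | j) hz
        · simp only [g, Finset.mem_filter, Finset.mem_univ, true_and, Sum.elim_inl] at hz
          exact absurd (hz ▸ hfI x) hi
        · simp only [g, Finset.mem_filter, Finset.mem_univ, true_and, Sum.elim_inr] at hz
          rw [Finset.mem_singleton]
          congr 1
          rw [← Equiv.symm_apply_eq]
          exact Subtype.ext hz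
    · rw [← htot, ← Finset.sum_fiberwise Finset.univ g u]
      refine Finset.sum_congr rfl fun i _ => Finset.sum_congr rfl fun z hz => ?_
      rcases z with x | j
      · simp only [g, Finset.mem_filter, Finset.mem_univ, true_and, Sum.elim_inl] at hz
        have hx : x ∈ F i := hz ▸ hfF x
        simp [efVal, hu, hx]
      · simp [efVal, hu]
end
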